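/- arXiv:1710.00627 — 2 statements merged into one kernel-verified Lean document; each statement's English description precedes it below -/
import Mathlib

section
/- Let X be a locally compact zero-dimensional space, let G be a group of homeomorphisms of X, let U be an open subset of X, and write U* for the union of all compact G-invariant subsets of U. Suppose that for every compact open subset V of U, the intersection ⋂_{g ∈ G} g(V) is open. Then U* is open in X and every point of U* is an almost periodic point for G. -/
open Filter Topology Set Pointwise Uniformity

namespace Reid

/-- The group of self-homeomorphisms of a space, with `(f * g) x = f (g x)`. -/
instance {X : Type*} [TopologicalSpace X] : Group (X ≃ₜ X) where
  mul f g := g.trans f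
  one := Homeomorph.refl X
  inv := Homeomorph.symm
  mul_assoc f g h := Homeomorph.ext fun _ => rfl
  one_mul f := Homeomorph.ext fun _ => rfl
  mul_one f := Homeomorph.ext fun _ => rfl
  inv_mul_cancel f := Homeomorph.ext f.symm_apply_apply

/-- The tautological action of the homeomorphism group on the space. -/
instance {X : Type*} [TopologicalSpace X] : MulAction (X ≃ₜ X) X where
  smul f x := f x
  one_smul _ := rfl
  mul_smul _ _ _ := rfl

/-- A topological space is zero-dimensional if it has a base of clopen sets
(Hausdorffness is imposed separately as an instance). -/
def ZeroDimensional (X : Type*) [TopologicalSpace X] : Prop :=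
  ∃ B : Set (Set X), TopologicalSpace.IsTopologicalBasis B ∧ ∀ U ∈ B, IsClopen U

/-- A point `x` is almost periodic for `G` if for every neighbourhood `U` of `x`, setting
`N = {h ∈ G | h x ∈ U}`, there is a finite `F ⊆ G` with `F N = G`. -/
def AlmostPeriodicPt {X : Type*} [TopologicalSpace X] (G : Subgroup (X ≃ₜ X)) (x : X) : Prop :=
  ∀ U ∈ 𝓝 x, ∃ F : Finset (X ≃ₜ X), (F : Set (X ≃ₜ X)) ⊆ (G : Set (X ≃ₜ X)) ∧
    ∀ g ∈ G, ∃ f ∈ F, (f⁻¹ * g) x ∈ U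

theorem ZeroDimensional.exists_isCompact_isOpen_between {X : Type*} [TopologicalSpace X]
    [T2Space X] [LocallyCompactSpace X] (hzd : ZeroDimensional X) {K U : Set X}
    (hK : IsCompact K) (hU : IsOpen U) (hKU : K ⊆ U) :
    ∃ V : Set X, K ⊆ V ∧ V ⊆ U ∧ IsCompact V ∧ IsOpen V := by
  obtain ⟨B, hB, hclopen⟩ := hzd
  refine hK.induction_on (p := fun s => ∃ V : Set X, s ⊆ V ∧ V ⊆ U ∧ IsCompact V ∧ IsOpen V)
    ⟨∅, Subset.rfl, empty_subset _, isCompact_empty, isOpen_empty⟩ ?_ ?_ ?_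
  · rintro s t hst ⟨V, htV, hV⟩
    exact ⟨V, hst.trans htV, hV⟩
  · rintro s t ⟨V, hsV, hVU, hVc, hVo⟩ ⟨V', htV, hVU', hVc', hVo'⟩
    exact ⟨V ∪ V', union_subset_union hsV htV, union_subset hVU hVU', hVc.union hVc',
      hVo.union hVo'⟩
  · intro x hx
    obtain ⟨C, hCx, hCU, hC⟩ := local_compact_nhds (hU.mem_nhds (hKU hx))
    obtain ⟨b, hbB, hxb, hbC⟩ := hB.mem_nhds_iff.1 hCx
    have hb := hclopen b hbB
    exact ⟨b, mem_nhdsWithin_of_mem_nhds (hb.isOpen.mem_nhds hxb), b, Subset.rfl,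
      hbC.trans hCU, hC.of_isClosed_subset hb.isClosed hbC, hb.isOpen⟩

section InvariantCore

variable {X : Type*} [TopologicalSpace X] (G : Subgroup (X ≃ₜ X))

theorem mem_iInter_image_iff {V : Set X} {y : X} :
    y ∈ ⋂ g ∈ G, (g : X ≃ₜ X) '' V ↔ ∀ g ∈ G, g y ∈ V := by
  simp only [mem_iInter]
  constructor
  · intro h g hg
    obtain ⟨v, hv, rfl⟩ := h g⁻¹ (G.inv_mem hg)
    rwa [show g (g⁻¹ v) = v from g.apply_symm_apply v]
  · intro h g hg
    exact ⟨g⁻¹ y, h _ (G.inv_mem hg), g.apply_symm_apply y⟩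

theorem iInter_image_subset (V : Set X) : ⋂ g ∈ G, (g : X ≃ₜ X) '' V ⊆ V :=
  fun _ hy => (mem_iInter_image_iff G).1 hy 1 G.one_mem

theorem apply_mem_iInter_image {V : Set X} {g : X ≃ₜ X} (hg : g ∈ G) {y : X}
    (hy : y ∈ ⋂ g ∈ G, (g : X ≃ₜ X) '' V) : g y ∈ ⋂ g ∈ G, (g : X ≃ₜ X) '' V :=
  (mem_iInter_image_iff G).2 fun h hh => (mem_iInter_image_iff G).1 hy (h * g) (G.mul_mem hh hg)

theorem image_iInter_image (V : Set X) {g : X ≃ₜ X} (hg : g ∈ G) :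
    g '' (⋂ g ∈ G, (g : X ≃ₜ X) '' V) = ⋂ g ∈ G, (g : X ≃ₜ X) '' V := by
  apply Subset.antisymm
  · rintro _ ⟨y, hy, rfl⟩
    exact apply_mem_iInter_image G hg hy
  · intro y hy
    exact ⟨g⁻¹ y, apply_mem_iInter_image G (G.inv_mem hg) hy, g.apply_symm_apply y⟩

theorem isCompact_iInter_image [T2Space X] {V : Set X} (hV : IsCompact V) :
    IsCompact (⋂ g ∈ G, (g : X ≃ₜ X) '' V) :=
  hV.of_isClosed_subset
    (isClosed_biInter fun g _ => (hV.image g.continuous).isClosed) (iInter_image_subset G V)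

theorem subset_iInter_image {K V : Set X} (hK : ∀ g ∈ G, (g : X ≃ₜ X) '' K = K) (hKV : K ⊆ V) :
    K ⊆ ⋂ g ∈ G, (g : X ≃ₜ X) '' V :=
  subset_iInter₂ fun g hg => (hK g hg).symm.subset.trans (image_mono hKV)

/-- If removing the open set `A` from an invariant compact set `W` leaves a set with open
invariant core, then finitely many translates of `A` cover the orbits of all points of `A`. -/
theorem exists_finset_forall_apply_mem {W A : Set X} (hW : IsCompact W)
    (hinv : ∀ g ∈ G, ∀ y ∈ W, g y ∈ W) (hA : IsOpen A) (hAW : A ⊆ W)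
    (hcore : IsOpen (⋂ g ∈ G, (g : X ≃ₜ X) '' (W \ A))) {x : X} (hx : x ∈ A) :
    ∃ F : Finset (X ≃ₜ X), (F : Set (X ≃ₜ X)) ⊆ (G : Set (X ≃ₜ X)) ∧
      ∀ g ∈ G, ∃ f ∈ F, (f⁻¹ * g) x ∈ A := by
  have hcover : W \ (⋂ g ∈ G, (g : X ≃ₜ X) '' (W \ A)) ⊆
      ⋃ g ∈ (G : Set (X ≃ₜ X)), (g : X ≃ₜ X) '' A := by
    rintro y ⟨hyW, hy⟩
    simp only [mem_iInter_image_iff, not_forall] at hy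
    obtain ⟨g, hg, hgy⟩ := hy
    have hgA : g y ∈ A := by
      by_contra h
      exact hgy ⟨hinv g hg y hyW, h⟩
    exact mem_biUnion (G.inv_mem hg) ⟨g y, hgA, g.symm_apply_apply y⟩
  obtain ⟨F, hFG, hF, hFcover⟩ := (hW.diff hcore).elim_finite_subcover_image
    (fun g _ => g.isOpenMap A hA) hcover
  refine ⟨hF.toFinset, by simpa using hFG, fun g hg => ?_⟩
  have hgx : g x ∈ W \ (⋂ g ∈ G, (g : X ≃ₜ X) '' (W \ A)) := by
    refine ⟨hinv g hg x (hAW hx), fun h => ?_⟩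
    have := (mem_iInter_image_iff G).1 h g⁻¹ (G.inv_mem hg)
    rw [show g⁻¹ (g x) = x from g.symm_apply_apply x] at this
    exact this.2 hx
  obtain ⟨f, hf, a, ha, hax⟩ := mem_iUnion₂.1 (hFcover hgx)
  refine ⟨f, hF.mem_toFinset.2 hf, ?_⟩
  rwa [show (f⁻¹ * g) x = f.symm (g x) from rfl, ← hax, f.symm_apply_apply]

end InvariantCore

/-- Proposition 3.7(iii): if `X` is locally compact zero-dimensional, `U ⊆ X` is open, `U*` is
the union of all compact `G`-invariant subsets of `U`, and `⋂_{g ∈ G} g(V)` is open for every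
compact open `V ⊆ U`, then `U*` is open and consists of almost periodic points for `G`. -/
theorem Ustar_open_almost_periodic {X : Type*} [TopologicalSpace X] [T2Space X]
    [LocallyCompactSpace X] (hzd : ZeroDimensional X)
    (G : Subgroup (X ≃ₜ X)) (U : Set X) (hU : IsOpen U)
    (Ustar : Set X)
    (hUstar : Ustar = ⋃₀ {K : Set X | K ⊆ U ∧ IsCompact K ∧ ∀ g ∈ G, (g : X ≃ₜ X) '' K = K})
    (hyp : ∀ V : Set X, V ⊆ U → IsCompact V → IsOpen V →
      IsOpen (⋂ g ∈ G, (g : X ≃ₜ X) '' V)) :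
    IsOpen Ustar ∧ ∀ x ∈ Ustar, AlmostPeriodicPt G x := by
  have key : ∀ x ∈ Ustar, ∃ W : Set X, x ∈ W ∧ W ⊆ U ∧ IsCompact W ∧ IsOpen W ∧
      ∀ g ∈ G, (g : X ≃ₜ X) '' W = W := by
    rw [hUstar]
    rintro x ⟨K, ⟨hKU, hK, hKG⟩, hxK⟩
    obtain ⟨V, hKV, hVU, hV, hVo⟩ := hzd.exists_isCompact_isOpen_between hK hU hKU
    exact ⟨_, subset_iInter_image G hKG hKV hxK, (iInter_image_subset G V).trans hVU,
      isCompact_iInter_image G hV, hyp V hVU hV hVo, fun g hg => image_iInter_image G V hg⟩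
  refine ⟨isOpen_iff_mem_nhds.2 fun x hx => ?_, fun x hx O hO => ?_⟩
  · obtain ⟨W, hxW, hWU, hW, hWo, hWG⟩ := key x hx
    rw [hUstar]
    exact mem_of_superset (hWo.mem_nhds hxW) (subset_sUnion_of_mem ⟨hWU, hW, hWG⟩)
  · obtain ⟨W, hxW, hWU, hW, hWo, hWG⟩ := key x hx
    obtain ⟨A, hxA, hAO, hA, hAo⟩ := hzd.exists_isCompact_isOpen_between
      (isCompact_singleton (x := x)) (isOpen_interior.inter hWo)
      (singleton_subset_iff.2 ⟨mem_interior_iff_mem_nhds.2 hO, hxW⟩)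
    obtain ⟨F, hFG, hF⟩ := exists_finset_forall_apply_mem G hW
      (fun g hg y hy => hWG g hg ▸ mem_image_of_mem g hy) hAo (hAO.trans inter_subset_right)
      (hyp _ (sdiff_subset.trans hWU) (hW.diff hAo) (hWo.sdiff hA.isClosed))
      (singleton_subset_iff.1 hxA)
    refine ⟨F, hFG, fun g hg => ?_⟩
    obtain ⟨f, hf, hfA⟩ := hF g hg
    exact ⟨f, hf, interior_subset (hAO hfA).1⟩

end Reid
end

section
/- Let X be a locally compact Hausdorff space, let G be a group of homeomorphisms of X, let S be a generating set for G with 1 ∈ S and S = S⁻¹, and let x ∈ X be an almost periodic point for G. Then x is S-recurrent. -/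
open Filter Topology Set Pointwise Uniformity

namespace Reid

/-- The word length of `g` with respect to a generating set `S` with `1 ∈ S = S⁻¹`:
the least `n` with `g ∈ S ^ n`. -/
noncomputable def wordLen {G : Type*} [Group G] (S : Set G) (g : G) : ℕ :=
  sInf {n : ℕ | g ∈ S ^ n}

/-- The set `K(g) = S^(|g|-1) g`. -/
def Kset {G : Type*} [Group G] (S : Set G) (g : G) : Set G :=
  S ^ (wordLen S g - 1) * {g}

/-- A net in `α`: a function to `α` from a nonempty directed preorder. -/
structure Net (α : Type u) : Type (u + 1) where
  ι : Type u
  str : Preorder ι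
  directed : IsDirected ι fun a b => str.le a b
  nonempty : Nonempty ι
  toFun : ι → α

/-- The `atTop` filter on the index type of a net. -/
def Net.atTop {α : Type u} (N : Net α) : Filter N.ι :=
  @Filter.atTop N.ι N.str

/-- A point `x` is `S`-recurrent if for every net `(g_i)` in `G = ⟨S⟩` with `|g_i| → ∞` and every
neighbourhood `U` of `x`, there are an integer `n`, a subnet `(g_{φ(j)})` and elements
`c_j ∈ K(g_{φ(j)})` with `c_j x ∈ U` and `|c_j| ≤ n` for all `j`. -/
def SRecurrent {X : Type u} [TopologicalSpace X] (S : Set (X ≃ₜ X)) (x : X) : Prop :=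
  ∀ N : Net (X ≃ₜ X), (∀ i, N.toFun i ∈ Subgroup.closure S) →
    Filter.Tendsto (fun i => wordLen S (N.toFun i)) N.atTop Filter.atTop →
    ∀ U ∈ 𝓝 x,
      ∃ (n : ℕ) (M : Net (X ≃ₜ X)) (φ : M.ι → N.ι) (c : M.ι → (X ≃ₜ X)),
        (∀ j, M.toFun j = N.toFun (φ j)) ∧
        Filter.Tendsto φ M.atTop N.atTop ∧
        ∀ j, c j ∈ Kset S (N.toFun (φ j)) ∧ (c j) x ∈ U ∧ wordLen S (c j) ≤ n

section WordLength

variable {G : Type*} [Group G] {S : Set G}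

theorem wordLen_le {g : G} {n : ℕ} (h : g ∈ S ^ n) : wordLen S g ≤ n :=
  Nat.sInf_le h

/-- Every element of the group generated by a symmetric set `S` is a product of elements of `S`. -/
theorem exists_mem_pow_of_mem_closure (hSinv : S⁻¹ = S) {g : G}
    (hg : g ∈ Subgroup.closure S) : ∃ n : ℕ, g ∈ S ^ n := by
  induction hg using Subgroup.closure_induction with
  | mem x hx => exact ⟨1, by simpa using hx⟩
  | one => exact ⟨0, by simp⟩
  | mul x y _ _ hx hy =>
    obtain ⟨m, hm⟩ := hx
    obtain ⟨n, hn⟩ := hy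
    exact ⟨m + n, by rw [pow_add]; exact mul_mem_mul hm hn⟩
  | inv x _ hx =>
    obtain ⟨m, hm⟩ := hx
    refine ⟨m, ?_⟩
    rw [← hSinv, inv_pow]
    exact inv_mem_inv.2 hm

theorem mem_pow_wordLen (hSinv : S⁻¹ = S) {g : G} (hg : g ∈ Subgroup.closure S) :
    g ∈ S ^ wordLen S g :=
  Nat.sInf_mem (exists_mem_pow_of_mem_closure hSinv hg)

/-- A finite subset of the group generated by `S` lies in some power of `S`. -/
theorem exists_finset_subset_pow (hS1 : 1 ∈ S) (hSinv : S⁻¹ = S) (F : Finset G)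
    (hF : (F : Set G) ⊆ Subgroup.closure S) : ∃ m : ℕ, (F : Set G) ⊆ S ^ m :=
  ⟨F.sup (wordLen S), fun _ hf =>
    pow_subset_pow_right hS1 (Finset.le_sup (f := wordLen S) hf) (mem_pow_wordLen hSinv (hF hf))⟩

theorem pow_subset_closure (n : ℕ) : S ^ n ⊆ Subgroup.closure S := by
  induction n with
  | zero => simp
  | succ n ih =>
    rw [pow_succ]
    rintro _ ⟨a, ha, b, hb, rfl⟩
    exact mul_mem (ih ha) (Subgroup.subset_closure hb)

/-- If `|g| > m`, then `K(g)` contains a translate `S ^ m * u` with `|u| ≤ m + 1`. -/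
theorem exists_pow_mul_subset_Kset (hSinv : S⁻¹ = S) {g : G} (hg : g ∈ Subgroup.closure S)
    {m : ℕ} (hm : m + 1 ≤ wordLen S g) : ∃ u ∈ S ^ (m + 1), S ^ m * {u} ⊆ Kset S g := by
  obtain ⟨k, hk⟩ := Nat.exists_eq_add_of_le' hm
  have hgk := mem_pow_wordLen hSinv hg
  rw [hk, pow_add] at hgk
  obtain ⟨h, hh, u, hu, rfl⟩ := Set.mem_mul.1 hgk
  have hh' : h⁻¹ ∈ S ^ k := by
    rw [← hSinv, inv_pow]
    exact inv_mem_inv.2 hh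
  refine ⟨u, hu, ?_⟩
  rw [mul_singleton]
  rintro _ ⟨a, ha, rfl⟩
  have hlen : wordLen S (h * u) - 1 = m + k := by omega
  refine Set.mem_mul.2 ⟨a * h⁻¹, ?_, h * u, rfl, by group⟩
  rw [hlen, pow_add]
  exact mul_mem_mul ha hh'

end WordLength

/-- The tail of a net consisting of the indices above `i₀`. -/
def Net.tail {α : Type u} (N : Net α) (i₀ : N.ι) : Net α :=
  letI := N.str
  { ι := {i : N.ι // i₀ ≤ i}
    str := inferInstance
    directed := by
      have := N.directed
      refine ⟨fun a b => ?_⟩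
      obtain ⟨c, hac, hbc⟩ := directed_of (· ≤ ·) a.1 b.1
      exact ⟨⟨c, a.2.trans hac⟩, hac, hbc⟩
    nonempty := ⟨⟨i₀, le_rfl⟩⟩
    toFun := fun i => N.toFun i.1 }

theorem Net.tendsto_tail_val {α : Type u} (N : Net α) (i₀ : N.ι) :
    Tendsto (fun i : (N.tail i₀).ι => i.1) (N.tail i₀).atTop N.atTop := by
  let := N.str
  have := N.directed
  refine tendsto_atTop.2 fun b => ?_
  obtain ⟨c, hac, hbc⟩ := directed_of (· ≤ ·) i₀ b
  exact mem_of_superset (mem_atTop (⟨c, hac⟩ : {i : N.ι // i₀ ≤ i})) fun j hj => hbc.trans hj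

theorem Net.exists_forall_ge_of_eventually {α : Type u} (N : Net α) {p : N.ι → Prop}
    (h : ∀ᶠ i in N.atTop, p i) : ∃ i₀, ∀ i, N.str.le i₀ i → p i := by
  let := N.str
  have := N.directed
  have := N.nonempty
  exact eventually_atTop.1 h

/-- Proposition 3.7(iv): an almost periodic point for `G = ⟨S⟩` (with `1 ∈ S = S⁻¹`) is
`S`-recurrent. -/
theorem sRecurrent_of_almostPeriodic {X : Type u} [TopologicalSpace X] [T2Space X]
    [LocallyCompactSpace X]
    (G : Subgroup (X ≃ₜ X)) (S : Set (X ≃ₜ X))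
    (hS1 : 1 ∈ S) (hSinv : S⁻¹ = S) (hSgen : Subgroup.closure S = G)
    (x : X) (hx : AlmostPeriodicPt G x) :
    SRecurrent S x := by
  intro N hN hlen U hU
  subst hSgen
  obtain ⟨F, hFG, hF⟩ := hx U hU
  obtain ⟨m, hFm⟩ := exists_finset_subset_pow hS1 hSinv F hFG
  obtain ⟨i₀, hi₀⟩ :=
    N.exists_forall_ge_of_eventually (hlen.eventually (eventually_ge_atTop (m + 1)))
  have key : ∀ j : (N.tail i₀).ι, ∃ c : X ≃ₜ X,
      c ∈ Kset S (N.toFun j.1) ∧ c x ∈ U ∧ wordLen S c ≤ m + (m + 1) := by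
    intro j
    obtain ⟨u, hu, huK⟩ := exists_pow_mul_subset_Kset hSinv (hN j.1) (hi₀ j.1 j.2)
    have huG : u ∈ Subgroup.closure S := pow_subset_closure _ hu
    obtain ⟨f, hf, hfU⟩ := hF u huG
    have hf' : f⁻¹ ∈ S ^ m := by
      rw [← hSinv, inv_pow]
      exact inv_mem_inv.2 (hFm hf)
    refine ⟨f⁻¹ * u, huK (mul_mem_mul hf' rfl), hfU, wordLen_le ?_⟩
    rw [pow_add]
    exact mul_mem_mul hf' hu
  choose c hc using key
  exact ⟨m + (m + 1), N.tail i₀, fun j => j.1, c, fun _ => rfl, N.tendsto_tail_val i₀, hc⟩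

end Reid
end
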